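/- arXiv:1309.0252 — 7 statements merged into one kernel-verified Lean document; each statement's English description precedes it below -/
import Mathlib

section
/- Let G be a finite connected simple graph on n ≥ 2 vertices, let P be a set of pairs of distinct vertices of G, and let V₁, V₂, …, V_ℓ be a partition of the vertex set of G. Suppose that for each i with 1 ≤ i ≤ ℓ there is a nonnegative integer k_i such that every vertex of V_i fails to resolve at least k_i pairs of P. Then Σ_{i=1}^{ℓ} |V_i|·k_i ≤ |P|·(res(G) − 1). -/
open SimpleGraph

/-- A set `S` of vertices is a resolving set of `G` if every pair of distinct vertices
`x, y` is resolved by some vertex `u ∈ S`, i.e. `d(u,x) ≠ d(u,y)`. -/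
def IsResolvingSet {V : Type*} (G : SimpleGraph V) (S : Set V) : Prop :=
  ∀ x y : V, x ≠ y → ∃ u ∈ S, G.dist u x ≠ G.dist u y

/-- The resolving number of `G`: the minimum `k` such that every `k`-element subset of the
vertex set is a resolving set of `G`. -/
noncomputable def resolvingNumber {V : Type*} [Fintype V] (G : SimpleGraph V) : ℕ :=
  sInf {k | ∀ S : Finset V, S.card = k → IsResolvingSet G ↑S}

theorem isResolvingSet_of_card_eq_resolvingNumber {V : Type*} [Fintype V] (G : SimpleGraph V)
    (S : Finset V) (hS : S.card = resolvingNumber G) : IsResolvingSet G ↑S := by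
  have hne : {k | ∀ S : Finset V, S.card = k → IsResolvingSet G ↑S}.Nonempty :=
    ⟨Fintype.card V + 1, fun T hT => absurd T.card_le_univ (by omega)⟩
  exact Nat.sInf_mem hne S hS

/-- A set of vertices none of which resolves the pair `x, y` has fewer than `res(G)` elements. -/
theorem card_lt_resolvingNumber {V : Type*} [Fintype V] (G : SimpleGraph V) {x y : V}
    (hxy : x ≠ y) (T : Finset V) (hT : ∀ u ∈ T, G.dist u x = G.dist u y) :
    T.card < resolvingNumber G := by
  by_contra! h
  obtain ⟨S, hST, hS⟩ := Finset.exists_subset_card_eq h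
  obtain ⟨u, hu, hne⟩ := isResolvingSet_of_card_eq_resolvingNumber G S hS x y hxy
  exact hne (hT u (hST hu))

open scoped Classical in
theorem stmt1 {V : Type*} [Fintype V] (G : SimpleGraph V) (hG : G.Connected)
    (hn : 2 ≤ Fintype.card V)
    (P : Finset (Sym2 V)) (hP : ∀ p ∈ P, ¬ p.IsDiag)
    (ℓ : ℕ) (W : Fin ℓ → Finset V) (k : Fin ℓ → ℕ)
    (hdisj : ∀ i j : Fin ℓ, i ≠ j → Disjoint (W i) (W j))
    (hcover : ∀ v : V, ∃ i, v ∈ W i)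
    (hfail : ∀ i : Fin ℓ, ∀ u ∈ W i,
      k i ≤ (P.filter fun p => ∀ x y : V, p = s(x, y) → G.dist u x = G.dist u y).card) :
    ∑ i, (W i).card * k i ≤ P.card * (resolvingNumber G - 1) := by
  let F : V → Sym2 V → Prop := fun u p => ∀ x y : V, p = s(x, y) → G.dist u x = G.dist u y
  have hpair : ∀ p ∈ P, (Finset.univ.filter fun u => F u p).card ≤ resolvingNumber G - 1 := by
    intro p hp
    induction p with
    | h x y =>
      have hxy : x ≠ y := fun h => hP _ hp (Sym2.mk_isDiag_iff.mpr h)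
      refine Nat.le_sub_one_of_lt (card_lt_resolvingNumber G hxy _ fun u hu => ?_)
      exact (Finset.mem_filter.mp hu).2 x y rfl
  calc ∑ i, (W i).card * k i
      ≤ ∑ i, ∑ u ∈ W i, (P.filter (F u)).card :=
        Finset.sum_le_sum fun i _ => Finset.card_nsmul_le_sum _ _ _ (hfail i)
    _ = ∑ u ∈ Finset.univ.biUnion W, (P.filter (F u)).card :=
        (Finset.sum_biUnion fun i _ j _ hij => hdisj i j hij).symm
    _ ≤ ∑ u, (P.filter (F u)).card :=
        Finset.sum_le_sum_of_subset (Finset.subset_univ _)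
    _ = ∑ p ∈ P, (Finset.univ.filter fun u => F u p).card :=
        Finset.sum_card_bipartiteAbove_eq_sum_card_bipartiteBelow F
    _ ≤ P.card * (resolvingNumber G - 1) := Finset.sum_le_card_nsmul _ _ _ hpair
end

section
/- Let G be a finite connected simple graph. Then res(G) ≤ 2 if and only if G is isomorphic to a path graph P_n for some n ≥ 1, or G is isomorphic to a cycle graph C_n for some odd n ≥ 3. -/
open SimpleGraph

namespace SimpleGraph

variable {V W : Type*}

/-- A function that vanishes only at `u`, is `1`-Lipschitz along edges, and decreases towards `u`
along some edge at each other vertex is the distance to `u`. -/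
theorem Connected.dist_eq_of_forall_adj {G : SimpleGraph V} (hG : G.Connected) {u : V} {f : V → ℕ}
    (h0 : f u = 0) (hlip : ∀ x y, G.Adj x y → f y ≤ f x + 1)
    (hdesc : ∀ x, x ≠ u → ∃ y, G.Adj x y ∧ f y < f x) (v : V) : G.dist u v = f v := by
  apply le_antisymm
  · induction hn : f v using Nat.strong_induction_on generalizing v with
    | _ n ih =>
      by_cases hv : v = u
      · simp [hv]
      · obtain ⟨y, hy, hlt⟩ := hdesc v hv
        have h1 := ih (f y) (hn ▸ hlt) y rfl
        have h2 := hG.dist_triangle (u := u) (v := y) (w := v)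
        have h3 := dist_eq_one_iff_adj.2 hy.symm
        omega
  · obtain ⟨p, hp⟩ := hG.exists_walk_length_eq_dist u v
    rw [← hp]
    clear hp
    have key : ∀ {x y : V} (p : G.Walk x y), f y ≤ f x + p.length := by
      intro x y p
      induction p with
      | nil => simp
      | cons h p ih =>
        have := hlip _ _ h
        rw [Walk.length_cons]
        omega
    simpa [h0] using key p

theorem dist_pathGraph {n : ℕ} (u v : Fin n) :
    (pathGraph n).dist u v = (u - v : ℕ) + (v - u : ℕ) := by
  have hG : (pathGraph n).Connected :=
    { preconnected := pathGraph_preconnected n, nonempty := ⟨u⟩ }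
  refine hG.dist_eq_of_forall_adj (f := fun v : Fin n ↦ (u - v : ℕ) + (v - u : ℕ))
    (by simp) ?_ ?_ v
  · intro x y h
    rw [pathGraph_adj] at h
    omega
  · intro x hx
    rw [Ne, Fin.ext_iff] at hx
    rcases Nat.lt_or_ge x u with h | h
    · exact ⟨⟨x + 1, by omega⟩, by rw [pathGraph_adj]; simp, by dsimp only; omega⟩
    · refine ⟨⟨x - 1, by omega⟩, ?_, by dsimp only; omega⟩
      rw [pathGraph_adj]
      dsimp only
      omega

theorem cycleGraph_adj_iff_val {n : ℕ} (hn : 3 ≤ n) (u v : Fin n) :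
    (cycleGraph n).Adj u v ↔ (u + 1 = (v : ℕ) ∨ v + 1 = (u : ℕ)) ∨
      (u = (0 : ℕ) ∧ v + 1 = n) ∨ (v = (0 : ℕ) ∧ u + 1 = n) := by
  rw [cycleGraph_adj']
  rcases lt_trichotomy u v with h | h | h
  · have h1 := Fin.coe_sub_iff_le.2 h.le
    have h2 := Fin.coe_sub_iff_lt.2 h
    rw [Fin.lt_def] at h
    omega
  · subst h
    have := Fin.coe_sub_iff_le.2 (le_refl u)
    omega
  · have h1 := Fin.coe_sub_iff_le.2 h.le
    have h2 := Fin.coe_sub_iff_lt.2 h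
    rw [Fin.lt_def] at h
    omega

theorem dist_cycleGraph {n : ℕ} (hn : 3 ≤ n) (u v : Fin n) :
    (cycleGraph n).dist u v =
      min ((u - v : ℕ) + (v - u : ℕ)) (n - ((u - v : ℕ) + (v - u : ℕ))) := by
  have hG : (cycleGraph n).Connected := by
    obtain ⟨m, rfl⟩ : ∃ m, n = m + 1 := ⟨n - 1, by omega⟩
    exact cycleGraph_connected
  refine hG.dist_eq_of_forall_adj (f := fun v : Fin n ↦
    min ((u - v : ℕ) + (v - u : ℕ)) (n - ((u - v : ℕ) + (v - u : ℕ)))) (by simp) ?_ ?_ v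
  · intro x y h
    rw [cycleGraph_adj_iff_val hn] at h
    omega
  · intro x hx
    rw [Ne, Fin.ext_iff] at hx
    let up : Fin n := ⟨if (x + 1 : ℕ) = n then 0 else (x + 1 : ℕ), by split_ifs <;> omega⟩
    let down : Fin n := ⟨if (x : ℕ) = 0 then n - 1 else x - 1, by split_ifs <;> omega⟩
    have hup : (up : ℕ) = if (x + 1 : ℕ) = n then 0 else (x + 1 : ℕ) := rfl
    have hdown : (down : ℕ) = if (x : ℕ) = 0 then n - 1 else x - 1 := rfl
    have adj_up : (cycleGraph n).Adj x up := by
      rw [cycleGraph_adj_iff_val hn, hup]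
      split_ifs <;> omega
    have adj_down : (cycleGraph n).Adj x down := by
      rw [cycleGraph_adj_iff_val hn, hdown]
      split_ifs <;> omega
    by_cases h : ((x : ℕ) < u ∧ 2 * (u - x : ℕ) ≤ n) ∨ ((u : ℕ) < x ∧ n < 2 * (x - u : ℕ))
    · refine ⟨up, adj_up, ?_⟩
      rw [hup]
      split_ifs <;> omega
    · refine ⟨down, adj_down, ?_⟩
      rw [hdown]
      split_ifs <;> omega

theorem two_mul_eq_of_dist_cycleGraph_eq {n : ℕ} (hn : 3 ≤ n) {x y c : Fin n} (hxy : x ≠ y)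
    (h : (cycleGraph n).dist c x = (cycleGraph n).dist c y) :
    (2 * c : ℕ) = x + y ∨ (2 * c : ℕ) = x + y + n ∨ (2 * c + n : ℕ) = x + y := by
  have hlt : ∀ z : Fin n, (c - z : ℕ) + (z - c : ℕ) < n := fun z ↦ by omega
  have h' : (c - x : ℕ) + (x - c : ℕ) = (c - y : ℕ) + (y - c : ℕ) ∨
      (c - x : ℕ) + (x - c : ℕ) + ((c - y : ℕ) + (y - c : ℕ)) = n := by
    have hltx := hlt x
    have hlty := hlt y
    rw [dist_cycleGraph hn, dist_cycleGraph hn] at h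
    generalize (c - x : ℕ) + (x - c : ℕ) = p at *
    generalize (c - y : ℕ) + (y - c : ℕ) = q at *
    omega
  rw [Ne, Fin.ext_iff] at hxy
  omega

theorem Iso.dist_map {G : SimpleGraph V} {H : SimpleGraph W} (e : G ≃g H) (hG : G.Connected)
    (u v : V) : H.dist (e u) (e v) = G.dist u v := by
  apply le_antisymm
  · obtain ⟨p, hp⟩ := hG.exists_walk_length_eq_dist u v
    rw [← hp, ← Walk.length_map e.toHom p]
    exact dist_le _
  · obtain ⟨p, hp⟩ := (e.connected_iff.1 hG).exists_walk_length_eq_dist (e u) (e v)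
    rw [← hp, ← Walk.length_map e.symm.toHom p]
    have h : G.dist (e.symm (e u)) (e.symm (e v)) ≤ _ := dist_le (p.map e.symm.toHom)
    simpa only [RelIso.symm_apply_apply] using h

/-- In a finite connected graph of maximum degree at most two, some path visits every vertex. -/
theorem Connected.exists_bijective_adj_succ [Finite V] {G : SimpleGraph V} (hG : G.Connected)
    (hdeg : ∀ v a b c, G.Adj v a → G.Adj v b → G.Adj v c → a = b ∨ a = c ∨ b = c) :
    ∃ (n : ℕ) (f : Fin n → V), Function.Bijective f ∧
      ∀ i j : Fin n, i + 1 = (j : ℕ) → G.Adj (f i) (f j) := by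
  classical
  have := Fintype.ofFinite V
  let P : ℕ → Prop := fun k ↦ ∃ f : ℕ → V, Set.InjOn f (Set.Iio k) ∧
    ∀ i, i + 1 < k → G.Adj (f i) (f (i + 1))
  have hP1 : P 1 := by
    obtain ⟨v⟩ := hG.nonempty
    refine ⟨fun _ ↦ v, ?_, fun i hi ↦ by omega⟩
    intro i hi j hj _
    simp only [Set.mem_Iio] at hi hj
    omega
  have hbound : ∀ k, P k → k ≤ Fintype.card V := by
    rintro k ⟨f, hf, -⟩
    have := Finset.card_le_card_of_injOn (s := Finset.range k) (t := Finset.univ) f (by simp)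
      (by simpa using hf)
    simpa using this
  let n := Nat.findGreatest P (Fintype.card V)
  have hmax : ∀ k, P k → k ≤ n := fun k hk ↦ Nat.le_findGreatest (hbound k hk) hk
  have hn : 1 ≤ n := hmax 1 hP1
  obtain ⟨f, hinj, hadj⟩ : P n := Nat.findGreatest_spec (hbound 1 hP1) hP1
  have hlast : ∀ v, G.Adj (f (n - 1)) v → ∃ i < n, f i = v := by
    intro v hv
    by_contra! hnot
    have : n + 1 ≤ n := by
      refine hmax _ ⟨Function.update f n v, ?_, ?_⟩
      · intro i hi j hj hij
        simp only [Set.mem_Iio] at hi hj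
        simp only [Function.update_apply] at hij
        split_ifs at hij with h1 h2 h2
        · omega
        · exact absurd hij.symm (hnot j (by omega))
        · exact absurd hij (hnot i (by omega))
        · exact hinj (by simp; omega) (by simp; omega) hij
      · intro i hi
        simp only [Function.update_apply]
        rw [if_neg (by omega)]
        split_ifs with h
        · rwa [show i = n - 1 by omega]
        · exact hadj i (by omega)
    omega
  have hfirst : ∀ v, G.Adj (f 0) v → ∃ i < n, f i = v := by
    intro v hv
    by_contra! hnot
    have : n + 1 ≤ n := by
      refine hmax _ ⟨fun i ↦ if i = 0 then v else f (i - 1), ?_, ?_⟩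
      · intro i hi j hj hij
        simp only [Set.mem_Iio] at hi hj
        dsimp only at hij
        split_ifs at hij with h1 h2 h2
        · omega
        · exact absurd hij.symm (hnot (j - 1) (by omega))
        · exact absurd hij (hnot (i - 1) (by omega))
        · have := hinj (by simp; omega) (by simp; omega) hij
          omega
      · intro i hi
        dsimp only
        rw [if_neg (Nat.succ_ne_zero i)]
        split_ifs with h
        · simpa [h] using hv.symm
        · have := hadj (i - 1) (by omega)
          rwa [Nat.sub_add_cancel (by omega)] at this
    omega
  have hclosed : ∀ i < n, ∀ v, G.Adj (f i) v → ∃ j < n, f j = v := by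
    intro i hi v hv
    by_cases h0 : i = 0
    · exact hfirst v (h0 ▸ hv)
    by_cases hl : i = n - 1
    · exact hlast v (hl ▸ hv)
    have h1 := hadj (i - 1) (by omega)
    rw [Nat.sub_add_cancel (by omega)] at h1
    rcases hdeg _ _ _ _ h1.symm (hadj i (by omega)) hv with h | h | h
    · have := hinj (by simp; omega) (by simp; omega) h
      omega
    · exact ⟨_, by omega, h⟩
    · exact ⟨_, by omega, h⟩
  have hsurj : ∀ v, ∃ i < n, f i = v := by
    have key : ∀ {x y : V} (p : G.Walk x y), (∃ i < n, f i = x) → ∃ i < n, f i = y := by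
      intro x y p
      induction p with
      | nil => exact id
      | cons h p ih =>
        rintro ⟨i, hi, rfl⟩
        exact ih (hclosed i hi _ h)
    intro v
    obtain ⟨p⟩ := hG.preconnected (f 0) v
    exact key p ⟨0, hn, rfl⟩
  refine ⟨n, fun i ↦ f i, ⟨fun i j h ↦ Fin.ext (hinj i.2 j.2 h), fun v ↦ ?_⟩, ?_⟩
  · obtain ⟨i, hi, h⟩ := hsurj v
    exact ⟨⟨i, hi⟩, h⟩
  · intro i j hij
    have := hadj i (by omega)
    rwa [hij] at this

/-- A finite connected graph of maximum degree at most two is a path or a cycle. -/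
theorem Connected.iso_pathGraph_or_cycleGraph [Finite V] {G : SimpleGraph V} (hG : G.Connected)
    (hdeg : ∀ v a b c, G.Adj v a → G.Adj v b → G.Adj v c → a = b ∨ a = c ∨ b = c) :
    (∃ n : ℕ, 1 ≤ n ∧ Nonempty (G ≃g pathGraph n)) ∨
      ∃ n : ℕ, 3 ≤ n ∧ Nonempty (G ≃g cycleGraph n) := by
  obtain ⟨n, f, hf, hadj⟩ := hG.exists_bijective_adj_succ hdeg
  have hchord : ∀ i j : Fin n, i + 1 < (j : ℕ) → G.Adj (f i) (f j) →
      i = (0 : ℕ) ∧ j + 1 = n := by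
    intro i j hij h
    constructor
    · by_contra hi
      have h1 := hadj ⟨i - 1, by omega⟩ i (by dsimp only; omega)
      have h2 := hadj i ⟨i + 1, by omega⟩ rfl
      rcases hdeg _ _ _ _ h1.symm h2 h with h | h | h <;>
      · have := Fin.ext_iff.1 (hf.1 h)
        dsimp only at this
        omega
    · by_contra hj
      have h1 := hadj ⟨j - 1, by omega⟩ j (by dsimp only; omega)
      have h2 := hadj j ⟨j + 1, by omega⟩ rfl
      rcases hdeg _ _ _ _ h1.symm h2 h.symm with h | h | h <;>
      · have := Fin.ext_iff.1 (hf.1 h)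
        dsimp only at this
        omega
  have hcases : ∀ i j : Fin n, G.Adj (f i) (f j) → (i + 1 = (j : ℕ) ∨ j + 1 = (i : ℕ)) ∨
      (i + 1 < (j : ℕ) ∧ i = (0 : ℕ) ∧ j + 1 = n) ∨
      (j + 1 < (i : ℕ) ∧ j = (0 : ℕ) ∧ i + 1 = n) := by
    intro i j h
    have hne : (i : ℕ) ≠ j := fun e ↦ h.ne (congrArg f (Fin.ext e))
    by_cases h1 : i + 1 < (j : ℕ)
    · exact .inr (.inl ⟨h1, hchord i j h1 h⟩)
    by_cases h2 : j + 1 < (i : ℕ)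
    · exact .inr (.inr ⟨h2, hchord j i h2 h.symm⟩)
    omega
  have hpath : ∀ i j : Fin n, i + 1 = (j : ℕ) ∨ j + 1 = (i : ℕ) → G.Adj (f i) (f j) :=
    fun i j h ↦ h.elim (hadj i j) fun h ↦ (hadj j i h).symm
  have hn : 1 ≤ n := by
    obtain ⟨v⟩ := hG.nonempty
    obtain ⟨i, -⟩ := hf.2 v
    exact i.pos
  by_cases hclose : ∃ i j : Fin n, i + 1 < (j : ℕ) ∧ G.Adj (f i) (f j)
  · obtain ⟨a, b, hab, h⟩ := hclose
    obtain ⟨ha, hb⟩ := hchord a b hab h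
    have hn3 : 3 ≤ n := by omega
    refine .inr ⟨n, hn3, ⟨(⟨Equiv.ofBijective f hf, ?_⟩ : cycleGraph n ≃g G).symm⟩⟩
    intro i j
    rw [cycleGraph_adj_iff_val hn3, Equiv.ofBijective_apply, Equiv.ofBijective_apply]
    constructor
    · intro h
      have := hcases i j h
      omega
    · rintro (h' | ⟨hi, hj⟩ | ⟨hj, hi⟩)
      · exact hpath i j h'
      · rwa [show i = a from Fin.ext (by omega), show j = b from Fin.ext (by omega)]
      · rw [show i = b from Fin.ext (by omega), show j = a from Fin.ext (by omega)]
        exact h.symm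
  · push Not at hclose
    refine .inl ⟨n, hn, ⟨(⟨Equiv.ofBijective f hf, ?_⟩ : pathGraph n ≃g G).symm⟩⟩
    intro i j
    rw [pathGraph_adj, Equiv.ofBijective_apply, Equiv.ofBijective_apply]
    refine ⟨fun h ↦ ?_, hpath i j⟩
    rcases hcases i j h with h' | ⟨h', -⟩ | ⟨h', -⟩
    · exact h'
    · exact absurd h (hclose i j h')
    · exact absurd h.symm (hclose j i h')

/-- If every two distinct vertices resolve `G`, then `G` has maximum degree at most two. -/
theorem eq_or_eq_or_eq_of_adj_of_dist_eq_imp_eq {G : SimpleGraph V}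
    (h : ∀ x y, x ≠ y → ∀ a b, G.dist a x = G.dist a y → G.dist b x = G.dist b y → a = b)
    (v a b c : V) (ha : G.Adj v a) (hb : G.Adj v b) (hc : G.Adj v c) :
    a = b ∨ a = c ∨ b = c := by
  by_contra! hne
  obtain ⟨hab, hac, hbc⟩ := hne
  have dist_eq_two : ∀ x y, x ≠ y → G.Adj v x → G.Adj v y → ¬ G.Adj x y → G.dist x y = 2 := by
    intro x y hxy hx hy hnadj
    have hreach : G.Reachable x y := hx.symm.reachable.trans hy.reachable
    have h1 := hreach.one_lt_dist_of_ne_of_not_adj hxy hnadj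
    have h2 : G.dist x y ≤ 2 := dist_le (.cons hx.symm (.cons hy .nil))
    omega
  have key : ∀ x y z, x ≠ y → z ≠ x → z ≠ y → G.Adj v x → G.Adj v y → G.Adj v z →
      ¬ (G.Adj z x ↔ G.Adj z y) := by
    intro x y z hxy hzx hzy hx hy hz hiff
    refine hz.ne (h x y hxy v z ?_ ?_)
    · rw [dist_eq_one_iff_adj.2 hx, dist_eq_one_iff_adj.2 hy]
    · by_cases hadj : G.Adj z x
      · rw [dist_eq_one_iff_adj.2 hadj, dist_eq_one_iff_adj.2 (hiff.1 hadj)]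
      · rw [dist_eq_two z x hzx hz hx hadj, dist_eq_two z y hzy hz hy (mt hiff.2 hadj)]
  have h1 := key a b c hab hac.symm hbc.symm ha hb hc
  have h2 := key a c b hac hab.symm hbc ha hc hb
  have h3 := key b c a hbc hab hac hb hc ha
  rw [G.adj_comm c a, G.adj_comm c b] at h1
  rw [G.adj_comm b a] at h2
  tauto

end SimpleGraph

theorem IsResolvingSet.mono {V : Type*} {G : SimpleGraph V} {S T : Set V}
    (hS : IsResolvingSet G S) (hST : S ⊆ T) : IsResolvingSet G T := fun x y hxy ↦
  let ⟨u, hu, h⟩ := hS x y hxy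
  ⟨u, hST hu, h⟩

theorem resolvingNumber_le_iff {V : Type*} [Fintype V] (G : SimpleGraph V) (k : ℕ) :
    resolvingNumber G ≤ k ↔ ∀ S : Finset V, S.card = k → IsResolvingSet G ↑S := by
  refine ⟨fun h S hS ↦ ?_, fun h ↦ Nat.sInf_le h⟩
  have hne : {k | ∀ S : Finset V, S.card = k → IsResolvingSet G ↑S}.Nonempty := by
    refine ⟨Fintype.card V + 1, fun S hS ↦ ?_⟩
    have := S.card_le_univ
    omega
  obtain ⟨T, hTS, hT⟩ := Finset.exists_subset_card_eq (h.trans_eq hS.symm)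
  exact (Nat.sInf_mem hne T hT).mono (by exact_mod_cast hTS)

theorem resolvingNumber_le_two_iff {V : Type*} [Fintype V] (G : SimpleGraph V) :
    resolvingNumber G ≤ 2 ↔ ∀ x y, x ≠ y → ∀ a b,
      G.dist a x = G.dist a y → G.dist b x = G.dist b y → a = b := by
  classical
  rw [resolvingNumber_le_iff]
  constructor
  · intro h x y hxy a b ha hb
    by_contra hab
    obtain ⟨u, hu, hne⟩ := h {a, b} (Finset.card_pair hab) x y hxy
    have : u = a ∨ u = b := by simpa using hu
    rcases this with rfl | rfl
    · exact hne ha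
    · exact hne hb
  · intro h S hS x y hxy
    obtain ⟨a, b, hab, rfl⟩ := Finset.card_eq_two.1 hS
    by_contra! hnot
    exact hab (h x y hxy a b (hnot a (by simp)) (hnot b (by simp)))

theorem SimpleGraph.Iso.resolvingNumber_le_two_iff {V W : Type*} [Fintype V] [Fintype W]
    {G : SimpleGraph V} {H : SimpleGraph W} (e : G ≃g H) (hG : G.Connected) :
    resolvingNumber G ≤ 2 ↔ resolvingNumber H ≤ 2 := by
  simp only [_root_.resolvingNumber_le_two_iff, ← e.toEquiv.forall_congr_right, RelIso.coe_fn_toEquiv,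
    e.dist_map hG, ne_eq, e.injective.eq_iff]

theorem resolvingNumber_pathGraph_le_two (n : ℕ) : resolvingNumber (pathGraph n) ≤ 2 := by
  rw [resolvingNumber_le_two_iff]
  intro x y hxy a b ha hb
  rw [dist_pathGraph, dist_pathGraph] at ha hb
  rw [Ne, Fin.ext_iff] at hxy
  rw [Fin.ext_iff]
  omega

theorem resolvingNumber_cycleGraph_le_two_iff {n : ℕ} (hn : 3 ≤ n) :
    resolvingNumber (cycleGraph n) ≤ 2 ↔ Odd n := by
  rw [resolvingNumber_le_two_iff]
  constructor
  · intro h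
    simp only [dist_cycleGraph hn] at h
    by_contra hodd
    obtain ⟨m, hm⟩ := Nat.not_odd_iff_even.1 hodd
    have := h ⟨1, by omega⟩ ⟨n - 1, by omega⟩ (by rw [Ne, Fin.ext_iff]; dsimp only; omega)
      ⟨0, by omega⟩ ⟨m, by omega⟩ (by dsimp only; omega) (by dsimp only; omega)
    rw [Fin.ext_iff] at this
    dsimp only at this
    omega
  · rintro ⟨m, hm⟩ x y hxy a b ha hb
    have hka := two_mul_eq_of_dist_cycleGraph_eq hn hxy ha
    have hkb := two_mul_eq_of_dist_cycleGraph_eq hn hxy hb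
    clear ha hb
    rw [Fin.ext_iff]
    omega

theorem stmt3 {V : Type*} [Fintype V] (G : SimpleGraph V) (hG : G.Connected) :
    resolvingNumber G ≤ 2 ↔
      (∃ n : ℕ, 1 ≤ n ∧ Nonempty (G ≃g pathGraph n)) ∨
      (∃ n : ℕ, Odd n ∧ 3 ≤ n ∧ Nonempty (G ≃g cycleGraph n)) := by
  constructor
  · intro h
    refine (hG.iso_pathGraph_or_cycleGraph (eq_or_eq_or_eq_of_adj_of_dist_eq_imp_eq
      ((resolvingNumber_le_two_iff G).1 h))).imp_right ?_
    rintro ⟨n, hn, ⟨e⟩⟩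
    exact ⟨n, (resolvingNumber_cycleGraph_le_two_iff hn).1
      ((e.resolvingNumber_le_two_iff hG).1 h), hn, ⟨e⟩⟩
  · rintro (⟨n, -, ⟨e⟩⟩ | ⟨n, hodd, hn, ⟨e⟩⟩)
    · exact (e.resolvingNumber_le_two_iff hG).2 (resolvingNumber_pathGraph_le_two n)
    · exact (e.resolvingNumber_le_two_iff hG).2
        ((resolvingNumber_cycleGraph_le_two_iff hn).2 hodd)
end

section
/- For every integer a ≥ 3, the graph obtained by attaching one pendant vertex to a single vertex of the odd cycle C_{2a+1} (i.e., the graph on 2a+2 vertices consisting of a cycle of length 2a+1 together with one extra vertex adjacent to exactly one cycle vertex) has girth 2a+1 and resolving number a+1; in particular the bound g(G) ≤ 2·res(G) − 1 is tight. -/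
open SimpleGraph

/-- The graph consisting of a cycle of length `2a+1` together with one pendant vertex attached
to the cycle vertex `0`. Vertices `0, …, 2a` form the cycle; vertex `2a+1` is the pendant. -/
def pendantCycle (a : ℕ) : SimpleGraph (Fin (2 * a + 2)) :=
  SimpleGraph.fromRel fun u v =>
    (u.val < 2 * a + 1 ∧ v.val < 2 * a + 1 ∧ (u.val + 1) % (2 * a + 1) = v.val) ∨
    (u.val = 2 * a + 1 ∧ v.val = 0)

theorem pendantCycle_adj_iff {a : ℕ} (ha : 1 ≤ a) (u v : Fin (2 * a + 2)) :
    (pendantCycle a).Adj u v ↔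
      (u.val ≤ 2 * a ∧ v.val ≤ 2 * a ∧ (u.val + 1 = v.val ∨ v.val + 1 = u.val ∨
        (u.val = 0 ∧ v.val = 2 * a) ∨ (v.val = 0 ∧ u.val = 2 * a))) ∨
      (u.val = 2 * a + 1 ∧ v.val = 0) ∨ (u.val = 0 ∧ v.val = 2 * a + 1) := by
  have hmod (x : ℕ) (hx : x < 2 * a + 1) :
      (x < 2 * a ∧ (x + 1) % (2 * a + 1) = x + 1) ∨
        (x = 2 * a ∧ (x + 1) % (2 * a + 1) = 0) := by
    rcases Nat.lt_or_ge x (2 * a) with h | h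
    · exact Or.inl ⟨h, Nat.mod_eq_of_lt (by omega)⟩
    · obtain rfl : x = 2 * a := by omega
      exact Or.inr ⟨rfl, Nat.mod_self _⟩
  rw [pendantCycle, SimpleGraph.fromRel_adj, Ne, Fin.ext_iff]
  have hu := hmod u.val
  have hv := hmod v.val
  omega

/-- The distance in the cycle of length `2 * a + 1` between the vertices `m` and `n`. -/
def cycleDist (a m n : ℕ) : ℕ :=
  min ((m - n) + (n - m)) (2 * a + 1 - ((m - n) + (n - m)))

/-- The distance in `pendantCycle a` as an explicit function of the vertex labels. -/
def pendantDist (a m n : ℕ) : ℕ :=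
  if m = n then 0
  else if m = 2 * a + 1 then cycleDist a 0 n + 1
  else if n = 2 * a + 1 then cycleDist a m 0 + 1
  else cycleDist a m n

/-- A function that vanishes only at `u`, changes by at most one along edges and can be decreased
along some edge at every other vertex is the distance from `u`. -/
theorem SimpleGraph.dist_eq_of_forall_adj {V : Type*} {G : SimpleGraph V} {u : V} {f : V → ℕ}
    (hu : f u = 0) (hle : ∀ v w, G.Adj v w → f w ≤ f v + 1)
    (hdesc : ∀ v, v ≠ u → ∃ w, G.Adj w v ∧ f w + 1 = f v) (v : V) : G.dist u v = f v := by
  have hlip : ∀ {x y : V} (p : G.Walk x y), f y ≤ f x + p.length := by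
    intro x y p
    induction p with
    | nil => simp
    | cons h p ih =>
      have := hle _ _ h
      rw [SimpleGraph.Walk.length_cons]
      omega
  have hwalk : ∀ n v, f v = n → ∃ p : G.Walk u v, p.length = n := by
    intro n
    induction n with
    | zero =>
      intro v hv
      by_cases h : v = u
      · subst h
        exact ⟨.nil, rfl⟩
      · obtain ⟨w, -, hw⟩ := hdesc v h
        omega
    | succ n ih =>
      intro v hv
      have h : v ≠ u := by
        rintro rfl
        omega
      obtain ⟨w, hadj, hw⟩ := hdesc v h
      obtain ⟨p, hp⟩ := ih w (by omega)
      exact ⟨p.concat hadj, by rw [SimpleGraph.Walk.length_concat, hp]⟩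
  obtain ⟨p, hp⟩ := hwalk _ v rfl
  obtain ⟨q, hq⟩ := p.reachable.exists_walk_length_eq_dist
  have h₁ := hlip q
  have h₂ := SimpleGraph.dist_le p
  omega

theorem pendantCycle_dist {a : ℕ} (ha : 1 ≤ a) (u v : Fin (2 * a + 2)) :
    (pendantCycle a).dist u v = pendantDist a u.val v.val := by
  refine SimpleGraph.dist_eq_of_forall_adj (u := u) (f := fun v => pendantDist a u.val v.val)
    (by simp [pendantDist]) ?_ ?_ v
  · intro v w h
    rw [pendantCycle_adj_iff ha] at h
    have := u.isLt
    simp only [pendantDist, cycleDist]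
    split_ifs <;> omega
  · intro v hv
    rw [Ne, Fin.ext_iff] at hv
    have hu' := u.isLt
    have hv' := v.isLt
    suffices h : ∃ n, ∃ hn : n < 2 * a + 2, (pendantCycle a).Adj ⟨n, hn⟩ v ∧
        pendantDist a u.val n + 1 = pendantDist a u.val v.val by
      obtain ⟨n, hn, h⟩ := h
      exact ⟨⟨n, hn⟩, h⟩
    simp only [pendantCycle_adj_iff ha]
    generalize u.val = m at *
    generalize v.val = k at *
    by_cases hk : k = 2 * a + 1
    · refine ⟨0, by omega, by omega, ?_⟩
      simp only [pendantDist, cycleDist]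
      split_ifs <;> first | contradiction | omega
    by_cases hm : m = 2 * a + 1
    · by_cases hk0 : k = 0
      · refine ⟨2 * a + 1, by omega, by omega, ?_⟩
        simp only [pendantDist, cycleDist]
        split_ifs <;> first | contradiction | omega
      by_cases hka : k ≤ a
      · refine ⟨k - 1, by omega, by omega, ?_⟩
        simp only [pendantDist, cycleDist]
        split_ifs <;> first | contradiction | omega
      · refine ⟨if k = 2 * a then 0 else k + 1, by split_ifs <;> omega,
          by split_ifs <;> omega, ?_⟩
        simp only [pendantDist, cycleDist]
        split_ifs <;> first | contradiction | omega
    by_cases hdown : (m < k ∧ k - m ≤ a) ∨ (k < m ∧ a < m - k)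
    · refine ⟨if k = 0 then 2 * a else k - 1, by split_ifs <;> omega,
        by split_ifs <;> omega, ?_⟩
      simp only [pendantDist, cycleDist]
      split_ifs <;> first | contradiction | omega
    · refine ⟨if k = 2 * a then 0 else k + 1, by split_ifs <;> omega,
        by split_ifs <;> omega, ?_⟩
      simp only [pendantDist, cycleDist]
      split_ifs <;> first | contradiction | omega

theorem SimpleGraph.Walk.IsCycle.mem_support_of_forall_adj {V : Type*} {G : SimpleGraph V}
    {c v x y : V} {w : G.Walk c c} (hw : w.IsCycle) (hv : v ∈ w.support)
    (h : ∀ z ∈ w.support, G.Adj v z → z = x ∨ z = y) :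
    x ≠ y ∧ x ∈ w.support ∧ y ∈ w.support := by
  have hcard := hw.ncard_neighborSet_toSubgraph_eq_two hv
  have hsub : w.toSubgraph.neighborSet v ⊆ {x, y} := fun z hz =>
    h z (w.mem_verts_toSubgraph.1 (w.toSubgraph.edge_vert (SimpleGraph.Subgraph.Adj.symm hz))) (SimpleGraph.Subgraph.Adj.adj_sub hz)
  have heq : w.toSubgraph.neighborSet v = {x, y} :=
    Set.eq_of_subset_of_ncard_le hsub (by
      rw [hcard]
      exact (Set.ncard_insert_le _ _).trans (by rw [Set.ncard_singleton]))
  have hmem : ∀ z ∈ ({x, y} : Set V), z ∈ w.support := fun z hz => by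
    rw [← heq] at hz
    exact w.mem_verts_toSubgraph.1 (w.toSubgraph.edge_vert (SimpleGraph.Subgraph.Adj.symm hz))
  refine ⟨?_, hmem x (by simp), hmem y (by simp)⟩
  rintro rfl
  rw [heq] at hcard
  simp at hcard

theorem pendantCycle_le_length {a : ℕ} (ha : 1 ≤ a) {c : Fin (2 * a + 2)}
    {w : (pendantCycle a).Walk c c} (hw : w.IsCycle) : 2 * a + 1 ≤ w.length := by
  have hpend : (⟨2 * a + 1, by omega⟩ : Fin (2 * a + 2)) ∉ w.support := fun hp =>
    (hw.mem_support_of_forall_adj (x := 0) (y := 0) hp fun z _ hz => by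
      rw [pendantCycle_adj_iff ha] at hz
      simp only [Fin.ext_iff, Fin.val_zero] at *
      omega).1 rfl
  have hne (z) (hz : z ∈ w.support) : z.val ≠ 2 * a + 1 := by
    intro h
    apply hpend
    convert hz
    exact h.symm
  have hnbr (n : ℕ) (hn : n ≤ 2 * a) (h : (⟨n, by omega⟩ : Fin (2 * a + 2)) ∈ w.support) :=
    hw.mem_support_of_forall_adj h
      (x := ⟨if n = 0 then 2 * a else n - 1, by split_ifs <;> omega⟩)
      (y := ⟨if n = 2 * a then 0 else n + 1, by split_ifs <;> omega⟩) fun z hz hadj => by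
        rw [pendantCycle_adj_iff ha] at hadj
        have := hne z hz
        simp only [Fin.ext_iff] at *
        split_ifs <;> omega
  have hzero : ∀ (n : ℕ) (hn : n ≤ 2 * a), (⟨n, by omega⟩ : Fin (2 * a + 2)) ∈ w.support →
      (0 : Fin (2 * a + 2)) ∈ w.support := by
    intro n
    induction n with
    | zero => exact fun _ h => h
    | succ n ih =>
      intro hn h
      exact ih (by omega) (by simpa using (hnbr _ hn h).2.1)
  have hall : ∀ (n : ℕ) (hn : n ≤ 2 * a), (⟨n, by omega⟩ : Fin (2 * a + 2)) ∈ w.support := by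
    intro n
    induction n with
    | zero =>
      intro _
      have hc := w.start_mem_support
      have := hne c hc
      exact hzero c.val (by omega) hc
    | succ n ih =>
      intro hn
      have h := (hnbr n (by omega) (ih (by omega))).2.2
      simpa [show n ≠ 2 * a by omega] using h
  have hsub : Finset.univ.image (Fin.castSucc : Fin (2 * a + 1) → Fin (2 * a + 2)) ⊆
      w.support.tail.toFinset := by
    intro z hz
    obtain ⟨i, -, rfl⟩ := Finset.mem_image.1 hz
    have hi := hall i.val (by omega)
    rw [List.mem_toFinset]
    rcases w.mem_support_iff.1 hi with h | h
    · exact h ▸ w.end_mem_tail_support hw.not_nil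
    · exact h
  have hcard := (Finset.card_le_card hsub).trans (List.toFinset_card_le _)
  rw [Finset.card_image_of_injective _ (Fin.castSucc_injective _), Finset.card_univ,
    Fintype.card_fin, List.length_tail, SimpleGraph.Walk.length_support] at hcard
  omega

theorem pendantCycle_egirth {a : ℕ} (ha : 1 ≤ a) :
    (pendantCycle a).egirth = ((2 * a + 1 : ℕ) : ℕ∞) := by
  apply le_antisymm
  · obtain ⟨n, hn⟩ : ∃ n, 2 * a + 1 = n + 3 := ⟨2 * a - 2, by omega⟩
    let f : Fin (n + 3) → Fin (2 * a + 2) := fun i => ⟨i.val, by omega⟩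
    have hf : Function.Injective f := fun i j h => by
      simpa [f, Fin.ext_iff] using h
    let φ : cycleGraph (n + 3) →g pendantCycle a :=
      { toFun := f
        map_rel' := by
          intro i j h
          rw [pendantCycle_adj_iff ha]
          rw [cycleGraph_adj'] at h
          have hle := fun h : j ≤ i => Fin.sub_val_of_le h
          have hle' := fun h : i ≤ j => Fin.sub_val_of_le h
          have hlt := Fin.coe_sub_iff_lt (a := i) (b := j)
          have hlt' := Fin.coe_sub_iff_lt (a := j) (b := i)
          rw [Fin.lt_def] at hlt hlt'
          rw [Fin.le_def] at hle hle'
          have h₁ := i.isLt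
          have h₂ := j.isLt
          simp only [f]
          omega }
    have h := SimpleGraph.egirth_le_length ((cycleGraph.isCycle_cycle (n := n)).map (f := φ) hf)
    rw [SimpleGraph.Walk.length_map, cycleGraph.length_cycle] at h
    rwa [hn]
  · exact SimpleGraph.le_egirth.2 fun c w hw => by
      exact_mod_cast pendantCycle_le_length ha hw

/-- At most `a` labels are equidistant from two distinct vertices of `pendantCycle a`. -/
theorem exists_superset_equidistant {a : ℕ} (ha : 3 ≤ a) {x y : ℕ} (hx : x < y)
    (hy : y < 2 * a + 2) :
    ∃ T : Finset ℕ, T.card ≤ a ∧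
      ∀ u < 2 * a + 2, pendantDist a u x = pendantDist a u y → u ∈ T := by
  by_cases hyp : y = 2 * a + 1
  · by_cases hx1 : x = 1
    · refine ⟨insert 0 (Finset.Icc (a + 2) (2 * a)), ?_, fun u hu h => ?_⟩
      · refine (Finset.card_insert_le _ _).trans ?_
        rw [Nat.card_Icc]
        omega
      · rw [Finset.mem_insert, Finset.mem_Icc]
        simp only [pendantDist, cycleDist] at h
        split_ifs at h <;> omega
    by_cases hx2 : x = 2 * a
    · refine ⟨Finset.range a, by simp, fun u hu h => ?_⟩
      rw [Finset.mem_range]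
      simp only [pendantDist, cycleDist] at h
      split_ifs at h <;> omega
    · refine ⟨if x % 2 = 1 then {(x - 1) / 2, (x + 1) / 2} else {a + x / 2, a + x / 2 + 1},
        ?_, fun u hu h => ?_⟩
      · split_ifs <;> exact Finset.card_le_two.trans (by omega)
      · simp only [pendantDist, cycleDist] at h
        split_ifs at h ⊢ <;> simp only [Finset.mem_insert, Finset.mem_singleton] <;> omega
  · refine ⟨{(if (x + y) % 2 = 0 then (x + y) / 2
      else if x + y < 2 * a + 1 then (x + y + 2 * a + 1) / 2 else (x + y - (2 * a + 1)) / 2),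
      2 * a + 1}, Finset.card_le_two.trans (by omega), fun u hu h => ?_⟩
    rw [Finset.mem_insert, Finset.mem_singleton]
    simp only [pendantDist, cycleDist] at h
    split_ifs at h ⊢ <;> omega

theorem isResolvingSet_pendantCycle {a : ℕ} (ha : 3 ≤ a) {S : Finset (Fin (2 * a + 2))}
    (hS : S.card = a + 1) : IsResolvingSet (pendantCycle a) ↑S := by
  intro x y hxy
  wlog h : x < y generalizing x y
  · obtain ⟨u, hu, hne⟩ := this y x hxy.symm (lt_of_le_of_ne (not_lt.1 h) hxy.symm)
    exact ⟨u, hu, hne.symm⟩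
  by_contra! hcon
  obtain ⟨T, hT, hmem⟩ := exists_superset_equidistant ha (Fin.lt_def.1 h) y.isLt
  have hsub : S.map Fin.valEmbedding ⊆ T := by
    intro n hn
    obtain ⟨u, hu, rfl⟩ := Finset.mem_map.1 hn
    have := hcon u hu
    rw [pendantCycle_dist (by omega), pendantCycle_dist (by omega)] at this
    exact hmem _ u.isLt this
  have := Finset.card_le_card hsub
  rw [Finset.card_map] at this
  omega

theorem exists_card_eq_not_isResolvingSet_pendantCycle {a k : ℕ} (ha : 1 ≤ a) (hk : k ≤ a) :
    ∃ S : Finset (Fin (2 * a + 2)), S.card = k ∧ ¬ IsResolvingSet (pendantCycle a) ↑S := by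
  refine ⟨Finset.univ.map (Fin.castLEEmb (show k ≤ 2 * a + 2 by omega)), by simp, fun h => ?_⟩
  obtain ⟨u, hu, hne⟩ := h ⟨2 * a, by omega⟩ ⟨2 * a + 1, by omega⟩ (by simp)
  obtain ⟨i, -, rfl⟩ := Finset.mem_map.1 (Finset.mem_coe.1 hu)
  apply hne
  have hi := i.isLt
  rw [pendantCycle_dist ha, pendantCycle_dist ha]
  simp only [Fin.castLEEmb_apply, Fin.val_castLE, pendantDist, cycleDist]
  split_ifs <;> omega

theorem resolvingNumber_pendantCycle {a : ℕ} (ha : 3 ≤ a) :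
    resolvingNumber (pendantCycle a) = a + 1 := by
  have hmem : a + 1 ∈ {k | ∀ S : Finset (Fin (2 * a + 2)), S.card = k →
      IsResolvingSet (pendantCycle a) ↑S} := fun S hS => isResolvingSet_pendantCycle ha hS
  refine le_antisymm (Nat.sInf_le hmem) (le_csInf ⟨_, hmem⟩ fun k hk => ?_)
  by_contra! hlt
  obtain ⟨S, hS, hnot⟩ :=
    exists_card_eq_not_isResolvingSet_pendantCycle (a := a) (k := k) (by omega) (by omega)
  exact hnot (hk S hS)

theorem stmt6 (a : ℕ) (ha : 3 ≤ a) :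
    (pendantCycle a).egirth = ((2 * a + 1 : ℕ) : ℕ∞) ∧
      resolvingNumber (pendantCycle a) = a + 1 ∧
      (pendantCycle a).girth = 2 * resolvingNumber (pendantCycle a) - 1 := by
  have hg := pendantCycle_egirth (a := a) (by omega)
  refine ⟨hg, resolvingNumber_pendantCycle ha, ?_⟩
  rw [resolvingNumber_pendantCycle ha, SimpleGraph.girth, hg, ENat.toNat_natCast]
  omega
end

section
/- Let G be a finite connected simple graph. Then the clique number of G satisfies ω(G) ≤ res(G) + 1. -/
open SimpleGraph

/-- A subset of a clique that misses two of its vertices is not resolving. -/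
theorem not_isResolvingSet_of_subset_clique {V : Type*} {G : SimpleGraph V} {K S : Set V}
    (hK : G.IsClique K) (hSK : S ⊆ K) {x y : V} (hx : x ∈ K \ S) (hy : y ∈ K \ S)
    (hxy : x ≠ y) : ¬ IsResolvingSet G S := by
  intro hS
  obtain ⟨u, hu, hne⟩ := hS x y hxy
  have hdist : ∀ z ∈ K \ S, G.dist u z = 1 := fun z hz =>
    dist_eq_one_iff_adj.2 <| hK (hSK hu) hz.1 fun h => hz.2 (h ▸ hu)
  exact hne ((hdist x hx).trans (hdist y hy).symm)

theorem stmt7 {V : Type*} [Fintype V] (G : SimpleGraph V) (hG : G.Connected) :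
    G.cliqueNum ≤ resolvingNumber G + 1 := by
  classical
  by_contra! hlt
  obtain ⟨K, hK⟩ := G.exists_isNClique_cliqueNum
  have hcard := hK.card_eq
  obtain ⟨S, hSK, hS⟩ := Finset.exists_subset_card_eq (s := K) (n := resolvingNumber G) (by omega)
  have hdiff : 1 < (K \ S).card := by
    rw [Finset.card_sdiff_of_subset hSK]
    omega
  obtain ⟨x, hx, y, hy, hxy⟩ := Finset.one_lt_card.1 hdiff
  exact not_isResolvingSet_of_subset_clique hK.isClique (Finset.coe_subset.2 hSK)
    (by simpa using hx) (by simpa using hy) hxy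
    (isResolvingSet_of_card_eq_resolvingNumber G S hS)
end

section
/- For integers a and b with 1 ≤ b < a, let G_{a,b} be the graph obtained from the complete graph K_a by adding one new vertex adjacent to exactly b vertices of K_a. Then res(G_{a,b}) = a. -/
open SimpleGraph

/-- The graph `G_{a,b}`: a complete graph on the `a` vertices `0, …, a-1`, together with one
extra vertex `a` adjacent to exactly the `b` vertices `0, …, b-1`. -/
def Gab (a b : ℕ) : SimpleGraph (Fin (a + 1)) :=
  SimpleGraph.fromRel fun u v =>
    (u.val < a ∧ v.val < a) ∨ (u.val = a ∧ v.val < b)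

theorem SimpleGraph.dist_iso_eq {V W : Type*} {G : SimpleGraph V} {H : SimpleGraph W}
    (f : G ≃g H) (u v : V) : H.dist (f u) (f v) = G.dist u v := by
  by_cases h : G.Reachable u v
  · apply le_antisymm
    · obtain ⟨p, hp⟩ := h.exists_walk_length_eq_dist
      simpa [hp] using SimpleGraph.dist_le (p.map f.toHom)
    · obtain ⟨p, hp⟩ := (h.map f.toHom).exists_walk_length_eq_dist
      have hle := SimpleGraph.dist_le (p.map f.symm.toHom)
      simpa [hp] using hle
  · rw [SimpleGraph.dist_eq_zero_of_not_reachable h,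
      SimpleGraph.dist_eq_zero_of_not_reachable (fun h' => h (f.reachable_iff.mp h'))]

/-- The transposition of two vertices with the same neighbours outside themselves is an
automorphism. -/
def SimpleGraph.swapIso {V : Type*} [DecidableEq V] {G : SimpleGraph V} {x y : V}
    (h : ∀ u, u ≠ x → u ≠ y → (G.Adj u x ↔ G.Adj u y)) : G ≃g G where
  toEquiv := Equiv.swap x y
  map_rel_iff' := by
    intro u v
    have hu := h u
    have hv := h v
    simp only [Equiv.swap_apply_def]
    grind [SimpleGraph.adj_comm, SimpleGraph.irrefl]

theorem not_isResolvingSet_of_twins {V : Type*} {G : SimpleGraph V} {x y : V} (hxy : x ≠ y)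
    (h : ∀ u, u ≠ x → u ≠ y → (G.Adj u x ↔ G.Adj u y)) {S : Set V} (hx : x ∉ S) (hy : y ∉ S) :
    ¬ IsResolvingSet G S := by
  classical
  intro hS
  obtain ⟨u, hu, hne⟩ := hS x y hxy
  have hux : u ≠ x := fun e => hx (e ▸ hu)
  have huy : u ≠ y := fun e => hy (e ▸ hu)
  have hd := SimpleGraph.dist_iso_eq (SimpleGraph.swapIso h) u x
  have e1 : SimpleGraph.swapIso h u = u := Equiv.swap_apply_of_ne_of_ne hux huy
  have e2 : SimpleGraph.swapIso h x = y := Equiv.swap_apply_left x y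
  rw [e1, e2] at hd
  exact hne hd.symm

theorem isResolvingSet_of_card {V : Type*} [Fintype V] {G : SimpleGraph V} (hG : G.Connected)
    {S : Finset V} (hS : Fintype.card V ≤ S.card + 1) : IsResolvingSet G ↑S := by
  classical
  intro x y hxy
  by_cases hx : x ∈ S
  · refine ⟨x, hx, ?_⟩
    rw [SimpleGraph.dist_self]
    exact (hG.pos_dist_of_ne hxy).ne
  · by_cases hy : y ∈ S
    · refine ⟨y, hy, ?_⟩
      rw [SimpleGraph.dist_self]
      exact (hG.pos_dist_of_ne hxy.symm).ne'
    · have := Finset.card_le_univ (insert x (insert y S))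
      rw [Finset.card_insert_of_notMem (by simp [hxy, hx]),
        Finset.card_insert_of_notMem hy] at this
      omega

theorem le_resolvingNumber_of_twins {V : Type*} [Fintype V] {G : SimpleGraph V} {x y : V}
    (hxy : x ≠ y) (h : ∀ u, u ≠ x → u ≠ y → (G.Adj u x ↔ G.Adj u y)) :
    Fintype.card V - 1 ≤ resolvingNumber G := by
  classical
  refine le_csInf ⟨Fintype.card V + 1, fun S hS => ?_⟩ fun k hk => ?_
  · have := Finset.card_le_univ S
    omega
  · by_contra hlt
    have hc : (Finset.univ \ {x, y} : Finset V).card = Fintype.card V - 2 := by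
      rw [← Finset.compl_eq_univ_sdiff, Finset.card_compl, Finset.card_pair hxy]
    obtain ⟨S, hS, hcard⟩ := Finset.exists_subset_card_eq
      (show k ≤ (Finset.univ \ {x, y} : Finset V).card by omega)
    refine not_isResolvingSet_of_twins hxy h ?_ ?_ (hk S hcard)
    · exact fun hx => by simpa using hS hx
    · exact fun hy => by simpa using hS hy

theorem Gab_adj {a b : ℕ} (u v : Fin (a + 1)) :
    (Gab a b).Adj u v ↔ u ≠ v ∧
      ((u.val < a ∧ v.val < a) ∨ (u.val = a ∧ v.val < b) ∨ (v.val = a ∧ u.val < b)) := by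
  simp only [Gab, SimpleGraph.fromRel_adj]
  tauto

theorem Gab_connected {a b : ℕ} (hb : 1 ≤ b) (hba : b < a) : (Gab a b).Connected := by
  have h0 : ∀ u : Fin (a + 1), (Gab a b).Reachable 0 u := by
    intro u
    by_cases hu : u = 0
    · rw [hu]
    · refine SimpleGraph.Adj.reachable ((Gab_adj _ _).2 ⟨Ne.symm hu, ?_⟩)
      have := u.isLt
      simp only [Fin.val_zero]
      omega
  exact { preconnected := fun u v => (h0 u).symm.trans (h0 v), nonempty := ⟨0⟩ }

theorem exists_twins_Gab {a b : ℕ} (hb : 1 ≤ b) (hba : b < a) :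
    ∃ x y : Fin (a + 1), x ≠ y ∧
      ∀ u, u ≠ x → u ≠ y → ((Gab a b).Adj u x ↔ (Gab a b).Adj u y) := by
  rcases hb.eq_or_lt with rfl | hb2
  · refine ⟨⟨1, by omega⟩, ⟨2, by omega⟩, by simp, fun u hx hy => ?_⟩
    have := u.isLt
    simp only [Gab_adj, ne_eq, Fin.ext_iff] at *
    omega
  · refine ⟨⟨0, by omega⟩, ⟨1, by omega⟩, by simp, fun u hx hy => ?_⟩
    have := u.isLt
    simp only [Gab_adj, ne_eq, Fin.ext_iff] at *
    omega

theorem stmt10 (a b : ℕ) (hb : 1 ≤ b) (hba : b < a) :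
    resolvingNumber (Gab a b) = a := by
  apply le_antisymm
  · exact Nat.sInf_le fun S hS => isResolvingSet_of_card (Gab_connected hb hba) (by simp [hS])
  · obtain ⟨x, y, hxy, h⟩ := exists_twins_Gab hb hba
    simpa using le_resolvingNumber_of_twins hxy h
end

section
/- Let G be a finite connected simple graph on n vertices that is not isomorphic to any path graph and not isomorphic to any cycle graph. If the girth of G equals 3, then n ≤ 3·res(G) − 3. -/
open SimpleGraph

/-- The vertices equidistant from two distinct vertices form a non-resolving set, so there are
fewer of them than the resolving number. -/
lemma card_equidistant_lt_resolvingNumber {V : Type*} [Fintype V] (G : SimpleGraph V) {x y : V}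
    (hxy : x ≠ y) (E : Finset V) (hE : ∀ u ∈ E, G.dist u x = G.dist u y) :
    E.card < resolvingNumber G := by
  have hmem : resolvingNumber G ∈ {k | ∀ S : Finset V, S.card = k → IsResolvingSet G ↑S} := by
    refine Nat.sInf_mem ⟨Fintype.card V + 1, fun S hS => ?_⟩
    have := S.card_le_univ
    omega
  by_contra! h
  obtain ⟨S, hSE, hS⟩ := Finset.exists_subset_card_eq h
  obtain ⟨u, hu, hne⟩ := hmem S hS x y hxy
  exact hne (hE u (hSE hu))

/-- A graph of girth three contains a triangle. -/
lemma exists_triangle_of_egirth_eq_three {V : Type*} {G : SimpleGraph V} (h : G.egirth = 3) :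
    ∃ a b c : V, G.Adj a b ∧ G.Adj b c ∧ G.Adj c a := by
  have hacyc : ¬ G.IsAcyclic := by
    rw [← egirth_eq_top, h]
    decide
  obtain ⟨a, w, -, hlen⟩ := exists_egirth_eq_length.2 hacyc
  have hw : w.length = 3 := by
    rw [h] at hlen
    exact_mod_cast hlen.symm
  match w, hw with
  | .cons hab (.cons hbc (.cons hca .nil)), _ => exact ⟨_, _, _, hab, hbc, hca⟩

/-- Every vertex is equidistant from two of the three vertices of a triangle. -/
lemma dist_eq_or_of_triangle {V : Type*} {G : SimpleGraph V} (hG : G.Connected) {a b c : V}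
    (hab : G.Adj a b) (hbc : G.Adj b c) (hca : G.Adj c a) (u : V) :
    G.dist u a = G.dist u b ∨ G.dist u b = G.dist u c ∨ G.dist u c = G.dist u a := by
  have key : ∀ {x y : V}, G.Adj x y → G.dist u y ≤ G.dist u x + 1 := fun {x y} hxy => by
    simpa [dist_eq_one_iff_adj.2 hxy] using hG.dist_triangle (u := u) (v := x) (w := y)
  have := key hab
  have := key hab.symm
  have := key hbc
  have := key hbc.symm
  have := key hca
  have := key hca.symm
  omega

theorem stmt11 {V : Type*} [Fintype V] (G : SimpleGraph V) (hG : G.Connected)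
    (hpath : ¬ ∃ n : ℕ, Nonempty (G ≃g pathGraph n))
    (hcycle : ¬ ∃ n : ℕ, Nonempty (G ≃g cycleGraph n))
    (hgirth : G.egirth = 3) :
    Fintype.card V ≤ 3 * resolvingNumber G - 3 := by
  classical
  obtain ⟨a, b, c, hab, hbc, hca⟩ := exists_triangle_of_egirth_eq_three hgirth
  let E (x y : V) : Finset V := Finset.univ.filter fun u => G.dist u x = G.dist u y
  have hE {x y : V} (h : G.Adj x y) : (E x y).card < resolvingNumber G :=
    card_equidistant_lt_resolvingNumber G h.ne _ (by simp [E])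
  have hcover : (Finset.univ : Finset V) ⊆ E a b ∪ E b c ∪ E c a := fun u _ => by
    simpa [E, or_assoc] using dist_eq_or_of_triangle hG hab hbc hca u
  have hcard := Finset.card_le_card hcover
  rw [Finset.card_univ] at hcard
  have := Finset.card_union_le (E a b ∪ E b c) (E c a)
  have := Finset.card_union_le (E a b) (E b c)
  have := hE hab
  have := hE hbc
  have := hE hca
  omega
end

section
/- Let G be a finite connected simple graph on n vertices that is not isomorphic to any path graph and not isomorphic to any cycle graph. If the girth of G equals 4, then n ≤ 4·res(G) − 4. -/
open SimpleGraph

open Classical in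
/-- The vertices which do not resolve a pair of distinct vertices are fewer than the
resolving number. -/
lemma card_filter_dist_eq_lt_resolvingNumber {V : Type*} [Fintype V] (G : SimpleGraph V)
    {x y : V} (hxy : x ≠ y) :
    (Finset.univ.filter fun u => G.dist u x = G.dist u y).card < resolvingNumber G := by
  have hmem : resolvingNumber G ∈
      {k | ∀ S : Finset V, S.card = k → IsResolvingSet G (S : Set V)} := by
    refine Nat.sInf_mem ⟨Fintype.card V + 1, fun S hS => ?_⟩
    have := S.card_le_univ
    omega
  by_contra! h
  obtain ⟨S, hSN, hS⟩ := Finset.exists_subset_card_eq h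
  obtain ⟨u, hu, hne⟩ := hmem S hS x y hxy
  exact hne (Finset.mem_filter.mp (hSN hu)).2

lemma SimpleGraph.exists_four_cycle_of_egirth_eq_four {V : Type*} {G : SimpleGraph V}
    (h : G.egirth = 4) :
    ∃ a b c d, G.Adj a b ∧ G.Adj b c ∧ G.Adj c d ∧ G.Adj d a ∧ a ≠ c ∧ b ≠ d := by
  have hacyc : ¬ G.IsAcyclic := by
    rw [← egirth_eq_top, h]
    decide
  obtain ⟨a, w, hw, hlen⟩ := exists_egirth_eq_length.mpr hacyc
  have hlen4 : w.length = 4 := by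
    rw [h] at hlen
    exact_mod_cast hlen.symm
  have hnodup := hw.support_nodup
  match w, hlen4 with
  | .cons (v := b) hab (.cons (v := c) hbc (.cons (v := d) hcd (.cons hda .nil))), _ =>
    simp at hnodup
    refine ⟨a, b, c, d, hab, hbc, hcd, hda, ?_, ?_⟩ <;> grind

/-- Around a 4-cycle, every vertex is equidistant from the ends of one of the two diagonals
or of one of two incident edges. -/
lemma SimpleGraph.Connected.dist_eq_of_four_cycle {V : Type*} {G : SimpleGraph V}
    (hG : G.Connected) {a b c d : V} (hab : G.Adj a b) (hbc : G.Adj b c) (hcd : G.Adj c d)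
    (hda : G.Adj d a) (u : V) :
    G.dist u a = G.dist u c ∨ G.dist u b = G.dist u d ∨
      G.dist u a = G.dist u b ∨ G.dist u b = G.dist u c := by
  have key : ∀ {x y}, G.Adj x y → G.dist u x ≤ G.dist u y + 1 ∧ G.dist u y ≤ G.dist u x + 1 := by
    intro x y hxy
    have h₁ := hG.dist_triangle (u := u) (v := x) (w := y)
    have h₂ := hG.dist_triangle (u := u) (v := y) (w := x)
    rw [dist_eq_one_iff_adj.mpr hxy] at h₁
    rw [dist_eq_one_iff_adj.mpr hxy.symm] at h₂
    exact ⟨h₂, h₁⟩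
  have h₁ := key hab
  have h₂ := key hbc
  have h₃ := key hcd
  have h₄ := key hda
  omega

theorem stmt12 {V : Type*} [Fintype V] (G : SimpleGraph V) (hG : G.Connected)
    (hpath : ¬ ∃ n : ℕ, Nonempty (G ≃g pathGraph n))
    (hcycle : ¬ ∃ n : ℕ, Nonempty (G ≃g cycleGraph n))
    (hgirth : G.egirth = 4) :
    Fintype.card V ≤ 4 * resolvingNumber G - 4 := by
  classical
  obtain ⟨a, b, c, d, hab, hbc, hcd, hda, hac, hbd⟩ :=
    exists_four_cycle_of_egirth_eq_four hgirth
  let N (x y : V) : Finset V := Finset.univ.filter fun u => G.dist u x = G.dist u y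
  have hN : ∀ {x y}, x ≠ y → (N x y).card < resolvingNumber G := fun hxy => by
    convert card_filter_dist_eq_lt_resolvingNumber G hxy
  have hcover : (Finset.univ : Finset V) ⊆ N a c ∪ (N b d ∪ (N a b ∪ N b c)) := fun u _ => by
    simpa [N] using hG.dist_eq_of_four_cycle hab hbc hcd hda u
  have hle := Finset.card_le_card hcover
  rw [Finset.card_univ] at hle
  have h₁ := Finset.card_union_le (N a c) (N b d ∪ (N a b ∪ N b c))
  have h₂ := Finset.card_union_le (N b d) (N a b ∪ N b c)
  have h₃ := Finset.card_union_le (N a b) (N b c)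
  have hac' := hN hac
  have hbd' := hN hbd
  have hab' := hN hab.ne
  have hbc' := hN hbc.ne
  omega
end
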